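/- Let g be a finite-dimensional semisimple real Lie algebra. Then there exists no bilinear product · : g × g → g such that x·y − y·x = ⁅x,y⁆ for all x,y ∈ g and L_⁅x,y⁆ = L_x ∘ L_y − L_y ∘ L_x for all x,y ∈ g, where L_x : g → g denotes the map y ↦ x·y. (Equivalently, by the Koszul–Medina correspondence: no connected semisimple real Lie group admits a left-invariant flat affine connection.) -/

import Mathlib

section helpers

attribute [local instance] LieRing.ofAssociativeRing

open LieAlgebra LieModule in
/-- For a faithful module over a Lie algebra with trivial radical, the trace form is
nondegenerate. -/
lemma traceForm_eq_zero_of_faithful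
    {L M : Type*} [LieRing L] [LieAlgebra ℝ L] [FiniteDimensional ℝ L] [HasTrivialRadical ℝ L]
    [AddCommGroup M] [Module ℝ M] [FiniteDimensional ℝ M] [LieRingModule L M] [LieModule ℝ L M]
    (hf : ∀ x : L, toEnd ℝ L M x = 0 → x = 0)
    (x : L) (hx : ∀ y, traceForm ℝ L M y x = 0) : x = 0 := by
  set I : LieIdeal ℝ L :=
    LieAlgebra.InvariantForm.orthogonal (traceForm ℝ L M) (traceForm_lieInvariant ℝ L M) ⊤ with hI
  have memI (z : L) : z ∈ I ↔ ∀ y, traceForm ℝ L M y z = 0 := by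
    rw [hI, LieAlgebra.InvariantForm.mem_orthogonal]; simp
  set DI : LieIdeal ℝ L := ⁅I, I⁆
  have tf_eq_zero : traceForm ℝ I M = 0 := by
    ext ⟨a, ha⟩ ⟨b, hb⟩
    change traceForm ℝ L M a b = 0
    exact (memI b).1 hb a
  have module_nilp : LieModule.IsNilpotent (derivedSeries ℝ I 1) M :=
    isNilpotent_derivedSeries_of_traceForm_eq_zero tf_eq_zero
  have ring_nilp : LieRing.IsNilpotent DI := by
    rw [LieAlgebra.isNilpotent_iff_forall (R := ℝ)]
    rintro ⟨z, hz⟩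
    apply LieSubalgebra.isNilpotent_ad_of_isNilpotent_ad (DI : LieSubalgebra ℝ L) (x := ⟨z, hz⟩)
    have h1 : IsNilpotent (toEnd ℝ L M z) := by
      refine (LieModule.isNilpotent_iff_forall' (R := ℝ)).mp module_nilp
        ⟨⟨z, LieSubmodule.lie_le_left I I hz⟩, ?_⟩
      rwa [LieIdeal.derivedSeries_eq_derivedSeriesOfIdeal_comap, LieIdeal.mem_comap]
    obtain ⟨n, hn⟩ := LieAlgebra.ad_nilpotent_of_nilpotent (R := ℝ) h1
    refine ⟨n, LinearMap.ext fun w ↦ hf _ ?_⟩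
    have key (k : ℕ) : toEnd ℝ L M ((ad ℝ L z ^ k) w) =
        ((ad ℝ (Module.End ℝ M) (toEnd ℝ L M z)) ^ k) (toEnd ℝ L M w) := by
      induction k with
      | zero => simp
      | succ k ih =>
        rw [pow_succ', pow_succ', Module.End.mul_apply, Module.End.mul_apply, ← ih]
        simp only [ad_apply, LieHom.map_lie]
    change toEnd ℝ L M ((ad ℝ L z ^ n) w) = 0
    rw [key, hn]; rfl
  have hsol : IsSolvable I := by
    obtain ⟨k, hk⟩ := IsSolvable.solvable ℝ DI
    rw [LieIdeal.derivedSeries_eq_bot_iff] at hk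
    refine IsSolvable.mk (k := k + 1) ((LieIdeal.derivedSeries_eq_bot_iff I (k + 1)).mpr ?_)
    rwa [derivedSeriesOfIdeal_add, derivedSeriesOfIdeal_succ, derivedSeriesOfIdeal_zero]
  have := HasTrivialRadical.eq_bot_of_isSolvable (R := ℝ) I
  have hxI : x ∈ I := (memI x).2 hx
  rw [this] at hxI
  simpa using hxI

open LieAlgebra LieModule in
/-- There is no bijective 1-cocycle on a nontrivial semisimple Lie algebra. -/
lemma no_bijective_cocycle
    {L M : Type*} [LieRing L] [LieAlgebra ℝ L] [FiniteDimensional ℝ L] [HasTrivialRadical ℝ L]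
    [Nontrivial L]
    [AddCommGroup M] [Module ℝ M] [FiniteDimensional ℝ M] [LieRingModule L M] [LieModule ℝ L M]
    (f : L ≃ₗ[ℝ] M) (hf : ∀ x y : L, f ⁅x, y⁆ = ⁅x, f y⁆ - ⁅y, f x⁆) : False := by
  -- the module is faithful
  have faithful : ∀ x : L, toEnd ℝ L M x = 0 → x = 0 := by
    have hab : IsLieAbelian (toEnd ℝ L M).ker := by
      refine ⟨fun a b ↦ ?_⟩
      have ha : ∀ m : M, ⁅(a : L), m⁆ = 0 := fun m ↦ by
        have := a.2
        rw [LieHom.mem_ker] at this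
        simpa using LinearMap.congr_fun this m
      have hb : ∀ m : M, ⁅(b : L), m⁆ = 0 := fun m ↦ by
        have := b.2
        rw [LieHom.mem_ker] at this
        simpa using LinearMap.congr_fun this m
      apply Subtype.ext
      apply f.injective
      have := hf a b
      rw [ha, hb] at this
      simpa using this
    have hbot : (toEnd ℝ L M).ker = ⊥ :=
      HasTrivialRadical.eq_bot_of_isSolvable (R := ℝ) _
    intro x hx
    have : x ∈ (toEnd ℝ L M).ker := by rwa [LieHom.mem_ker]
    rw [hbot] at this
    simpa using this
  set B := traceForm ℝ L M with hBdef
  have hsymm : LinearMap.BilinForm.IsSymm B :=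
    ⟨fun x y ↦ traceForm_comm ℝ L M x y⟩
  have hsep (x : L) (hx : ∀ y, B y x = 0) : x = 0 := traceForm_eq_zero_of_faithful faithful x hx
  have hB : B.Nondegenerate :=
    ⟨fun x hx ↦ hsep x fun y ↦ by rw [hBdef, traceForm_comm]; exact hx y, fun x hx ↦ hsep x hx⟩
  have hinv (x y z : L) : B ⁅x, y⁆ z = - B y ⁅x, z⁆ := traceForm_lieInvariant ℝ L M x y z
  -- traces vanish
  have htr (φ : L →ₗ[ℝ] ℝ) (hφ : ∀ x y : L, φ ⁅x, y⁆ = 0) (x : L) : φ x = 0 := by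
    obtain ⟨z, hz⟩ := (LinearMap.BilinForm.toDual B hB).surjective φ
    have hz' (y : L) : B z y = φ y := by rw [← hz]; rfl
    have hcen (y : L) : ⁅y, z⁆ = 0 := by
      refine hsep _ fun w ↦ ?_
      have h := hinv y w z
      have h2 : B ⁅y, w⁆ z = 0 := by
        rw [hBdef, traceForm_comm, ← hBdef, hz', hφ]
      linarith
    have hz0 : z = 0 := by
      have hK : z ∈ (⊥ : LieIdeal ℝ L) := by
        rw [← center_eq_bot (R := ℝ) (L := L), LieModule.mem_maxTrivSubmodule]
        exact hcen
      simpa using hK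
    rw [← hz', hz0]; simp
  have htrM (x : L) : LinearMap.trace ℝ M (toEnd ℝ L M x) = 0 :=
    htr (LinearMap.trace ℝ M ∘ₗ (toEnd ℝ L M : L →ₗ[ℝ] Module.End ℝ M)) (fun x y ↦ by simp) x
  have htrL (x : L) : LinearMap.trace ℝ L (ad ℝ L x) = 0 :=
    htr (LinearMap.trace ℝ L ∘ₗ (ad ℝ L : L →ₗ[ℝ] Module.End ℝ L)) (fun x y ↦ by
      simp) x
  -- Casimir
  let e := Module.finBasis ℝ L
  let e' := B.dualBasis hB e
  have hrep' (x : L) : x = ∑ i, B x (e i) • e' i := by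
    conv_lhs => rw [← e'.sum_repr x]
    simp [e', LinearMap.BilinForm.dualBasis_repr_apply]
  have hrep (x : L) : x = ∑ i, B x (e' i) • e i := by
    conv_lhs => rw [← e.sum_repr x]
    refine Finset.sum_congr rfl fun i _ ↦ ?_
    congr 1
    have := LinearMap.BilinForm.dualBasis_repr_apply hB e' x i
    rwa [LinearMap.BilinForm.dualBasis_dualBasis hB hsymm] at this
  have hcas (T : L →ₗ[ℝ] L →ₗ[ℝ] M) (x : L) :
      ∑ i, T ⁅x, e i⁆ (e' i) + ∑ i, T (e i) ⁅x, e' i⁆ = 0 := by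
    have h1 (i) : T ⁅x, e i⁆ (e' i) = ∑ j, B ⁅x, e i⁆ (e' j) • T (e j) (e' i) := by
      conv_lhs => rw [hrep ⁅x, e i⁆]
      simp
    have h2 (i) : T (e i) ⁅x, e' i⁆ = ∑ j, B ⁅x, e' i⁆ (e j) • T (e i) (e' j) := by
      conv_lhs => rw [hrep' ⁅x, e' i⁆]
      simp
    simp_rw [h1, h2]
    rw [Finset.sum_comm, ← Finset.sum_add_distrib]
    refine Finset.sum_eq_zero fun i _ ↦ ?_
    rw [← Finset.sum_add_distrib]
    refine Finset.sum_eq_zero fun j _ ↦ ?_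
    rw [← add_smul, hinv x (e j) (e' i), hBdef, traceForm_comm ℝ L M (e j), ]
    simp
  let C : Module.End ℝ M := ∑ i, toEnd ℝ L M (e i) ∘ₗ toEnd ℝ L M (e' i)
  let m : M := ∑ i, ⁅e i, f (e' i)⁆
  have hC (x : L) : ⁅x, m⁆ = C (f x) := by
    have h := hcas (LinearMap.compl₂ (toEnd ℝ L M : L →ₗ[ℝ] Module.End ℝ M) (f : L →ₗ[ℝ] M)) x
    simp only [LinearMap.compl₂_apply, LieHom.coe_toLinearMap, LinearEquiv.coe_coe,
      toEnd_apply_apply] at h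
    simp only [m, C, lie_sum, LinearMap.sum_apply, LinearMap.comp_apply, toEnd_apply_apply]
    rw [← sub_eq_zero, ← h, ← Finset.sum_sub_distrib, ← Finset.sum_add_distrib]
    refine Finset.sum_congr rfl fun i _ ↦ ?_
    rw [hf x (e' i), lie_sub, leibniz_lie x (e i)]
    abel
  have hCtr : LinearMap.trace ℝ M C = Module.finrank ℝ L := by
    simp only [C, map_sum]
    have hone (i) : LinearMap.trace ℝ M (toEnd ℝ L M (e i) ∘ₗ toEnd ℝ L M (e' i)) = 1 := by
      rw [← traceForm_apply_apply, ← hBdef, LinearMap.BilinForm.apply_dualBasis_right hB hsymm]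
      simp
    simp [hone]
  obtain ⟨a, ha⟩ := f.surjective m
  have hCeq : C = toEnd ℝ L M a - f.conj (ad ℝ L a) := by
    ext v
    obtain ⟨x, rfl⟩ := f.surjective v
    rw [← hC, ← ha]
    simp [LinearEquiv.conj_apply, hf a x]
  have h0 : LinearMap.trace ℝ M C = 0 := by
    rw [hCeq, map_sub, htrM, LinearMap.trace_conj', htrL, sub_zero]
  rw [hCtr] at h0
  have : 0 < Module.finrank ℝ L := Module.finrank_pos
  exact this.ne' (by exact_mod_cast h0)

end helpers

/-- **No flat affine structure on a semisimple Lie algebra** (Bon-Yau Chu).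
A finite-dimensional nontrivial semisimple real Lie algebra admits no bilinear
product `·` with `x·y − y·x = ⁅x,y⁆` and `L_⁅x,y⁆ = L_x ∘ L_y − L_y ∘ L_x`. -/
theorem no_flat_affine_structure_on_semisimple
    (g : Type*) [LieRing g] [LieAlgebra ℝ g] [FiniteDimensional ℝ g]
    [Nontrivial g] [LieAlgebra.IsSemisimple ℝ g] :
    ¬ ∃ P : g →ₗ[ℝ] g →ₗ[ℝ] g,
        (∀ x y : g, P x y - P y x = ⁅x, y⁆) ∧
        (∀ x y : g, P ⁅x, y⁆ = P x ∘ₗ P y - P y ∘ₗ P x) := by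
  rintro ⟨P, h1, h2⟩
  letI := LieRing.ofAssociativeRing (A := Module.End ℝ g)
  let φ : g →ₗ⁅ℝ⁆ Module.End ℝ g :=
    { toLinearMap := P
      map_lie' := by
        intro x y
        change P ⁅x, y⁆ = _
        rw [h2]; rfl }
  letI i1 : LieRingModule g g := LieRingModule.compLieHom (M := g) φ
  letI i2 : @LieModule ℝ g g _ _ _ _ _ i1 := LieModule.compLieHom (M := g) φ
  refine @no_bijective_cocycle g g _ _ _ _ _ _ _ _ i1 i2 (LinearEquiv.refl ℝ g) fun x y ↦ ?_
  exact (h1 x y).symm
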